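/- Let n ≥ 1, let Q = 2n + 2, and let α ∈ ℝ satisfy Q + α − 4 > 0. Then the constant (Q + α − 4)² (Q − α)² / 16 in the Rellich-type inequality on ℍⁿ is sharp: for every real number C > (Q + α − 4)² (Q − α)² / 16 there exists a real-valued f ∈ C_c^∞(ℝ^{2n+1} \ {0}) with ∫_{ℝ^{2n+1}} |z|² ρ^{α−6} f² dz dt > 0 such that ∫_{ℝ^{2n+1}} (ρ^{α+2}/|z|²) |Δ_ℍ f|² dz dt < C ∫_{ℝ^{2n+1}} |z|² ρ^{α−6} f² dz dt. -/

import Mathlib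

open MeasureTheory Real

noncomputable section

/-- The underlying space of the Heisenberg group ℍⁿ, identified with ℝ^{2n+1}:
points `(x, y, t)` with `x y : Fin n → ℝ`, `t : ℝ`; write `z = (x, y)`. -/
abbrev Hspace (n : ℕ) : Type := (Fin n → ℝ) × (Fin n → ℝ) × ℝ

/-- The horizontal vector field `X_j f = ∂f/∂x_j + 2 y_j ∂f/∂t`. -/
def Xd (n : ℕ) (j : Fin n) (f : Hspace n → ℝ) (p : Hspace n) : ℝ :=
  fderiv ℝ f p (Pi.single j 1, 0, 0) + 2 * p.2.1 j * fderiv ℝ f p (0, 0, 1)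

/-- The horizontal vector field `Y_j f = ∂f/∂y_j − 2 x_j ∂f/∂t`. -/
def Yd (n : ℕ) (j : Fin n) (f : Hspace n → ℝ) (p : Hspace n) : ℝ :=
  fderiv ℝ f p (0, Pi.single j 1, 0) - 2 * p.1 j * fderiv ℝ f p (0, 0, 1)

/-- Squared length of the horizontal gradient: `|∇_ℍ f|² = Σ_j ((X_j f)² + (Y_j f)²)`. -/
def gradH2 (n : ℕ) (f : Hspace n → ℝ) (p : Hspace n) : ℝ :=
  ∑ j : Fin n, ((Xd n j f p) ^ 2 + (Yd n j f p) ^ 2)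

/-- The Kohn sub-Laplacian `Δ_ℍ f = Σ_j (X_j(X_j f) + Y_j(Y_j f))`. -/
def lapH (n : ℕ) (f : Hspace n → ℝ) (p : Hspace n) : ℝ :=
  ∑ j : Fin n, (Xd n j (Xd n j f) p + Yd n j (Yd n j f) p)

/-- `|z|² = |x|² + |y|²`. -/
def zSq (n : ℕ) (p : Hspace n) : ℝ := ∑ j : Fin n, ((p.1 j) ^ 2 + (p.2.1 j) ^ 2)

/-- The homogeneous norm `ρ(z, t) = (|z|⁴ + t²)^{1/4}`. -/
def rho (n : ℕ) (p : Hspace n) : ℝ := ((zSq n p) ^ 2 + p.2.2 ^ 2) ^ ((4 : ℝ)⁻¹)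

/-- `N = ρ⁴`. -/
def NN (n : ℕ) (p : Hspace n) : ℝ := (zSq n p) ^ 2 + p.2.2 ^ 2

lemma zSq_nonneg (n : ℕ) (p : Hspace n) : 0 ≤ zSq n p :=
  Finset.sum_nonneg fun _ _ => by positivity

lemma NN_nonneg (n : ℕ) (p : Hspace n) : 0 ≤ NN n p := by
  unfold NN; positivity

lemma zSq_contDiff (n : ℕ) : ContDiff ℝ (⊤ : ℕ∞) (zSq n) := by
  unfold zSq; fun_prop

lemma NN_contDiff (n : ℕ) : ContDiff ℝ (⊤ : ℕ∞) (NN n) := by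
  have := zSq_contDiff n
  unfold NN; fun_prop

lemma hasFDerivAt_x (n : ℕ) (j : Fin n) (p : Hspace n) :
    HasFDerivAt (fun q : Hspace n => q.1 j)
      ((ContinuousLinearMap.proj (R := ℝ) (φ := fun _ : Fin n => ℝ) j).comp
        (ContinuousLinearMap.fst ℝ (Fin n → ℝ) ((Fin n → ℝ) × ℝ))) p :=
  ((ContinuousLinearMap.proj (R := ℝ) (φ := fun _ : Fin n => ℝ) j).comp
        (ContinuousLinearMap.fst ℝ (Fin n → ℝ) ((Fin n → ℝ) × ℝ))).hasFDerivAt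

lemma hasFDerivAt_y (n : ℕ) (j : Fin n) (p : Hspace n) :
    HasFDerivAt (fun q : Hspace n => q.2.1 j)
      ((ContinuousLinearMap.proj (R := ℝ) (φ := fun _ : Fin n => ℝ) j).comp
        ((ContinuousLinearMap.fst ℝ (Fin n → ℝ) ℝ).comp
        (ContinuousLinearMap.snd ℝ (Fin n → ℝ) ((Fin n → ℝ) × ℝ)))) p :=
  ((ContinuousLinearMap.proj (R := ℝ) (φ := fun _ : Fin n => ℝ) j).comp
        ((ContinuousLinearMap.fst ℝ (Fin n → ℝ) ℝ).comp
        (ContinuousLinearMap.snd ℝ (Fin n → ℝ) ((Fin n → ℝ) × ℝ)))).hasFDerivAt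

lemma hasFDerivAt_t (n : ℕ) (p : Hspace n) :
    HasFDerivAt (fun q : Hspace n => q.2.2)
      ((ContinuousLinearMap.snd ℝ (Fin n → ℝ) ℝ).comp
        (ContinuousLinearMap.snd ℝ (Fin n → ℝ) ((Fin n → ℝ) × ℝ))) p :=
  ((ContinuousLinearMap.snd ℝ (Fin n → ℝ) ℝ).comp
        (ContinuousLinearMap.snd ℝ (Fin n → ℝ) ((Fin n → ℝ) × ℝ))).hasFDerivAt

/-- derivative of `zSq` -/
def dz (n : ℕ) (p : Hspace n) : Hspace n →L[ℝ] ℝ :=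
  ∑ i : Fin n, ((2 * p.1 i) • ((ContinuousLinearMap.proj (R := ℝ) (φ := fun _ : Fin n => ℝ) i).comp
        (ContinuousLinearMap.fst ℝ (Fin n → ℝ) ((Fin n → ℝ) × ℝ))) +
    (2 * p.2.1 i) • ((ContinuousLinearMap.proj (R := ℝ) (φ := fun _ : Fin n => ℝ) i).comp
        ((ContinuousLinearMap.fst ℝ (Fin n → ℝ) ℝ).comp
        (ContinuousLinearMap.snd ℝ (Fin n → ℝ) ((Fin n → ℝ) × ℝ)))))

lemma hasFDerivAt_zSq (n : ℕ) (p : Hspace n) : HasFDerivAt (zSq n) (dz n p) p := by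
  unfold zSq dz
  refine HasFDerivAt.fun_sum fun i _ => ?_
  refine (((hasFDerivAt_x n i p).pow 2).add ((hasFDerivAt_y n i p).pow 2)).congr_fderiv ?_
  ext v <;> simp

lemma dz_apply (n : ℕ) (p v : Hspace n) :
    dz n p v = ∑ i : Fin n, (2 * p.1 i * v.1 i + 2 * p.2.1 i * v.2.1 i) := by
  simp [dz]

lemma dz_x (n : ℕ) (j : Fin n) (p : Hspace n) : dz n p (Pi.single j 1, 0, 0) = 2 * p.1 j := by
  rw [dz_apply]; simp [Pi.single_apply]

lemma dz_y (n : ℕ) (j : Fin n) (p : Hspace n) : dz n p (0, Pi.single j 1, 0) = 2 * p.2.1 j := by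
  rw [dz_apply]; simp [Pi.single_apply]

lemma dz_t (n : ℕ) (p : Hspace n) : dz n p (0, 0, 1) = 0 := by
  rw [dz_apply]; simp

lemma hasFDerivAt_NN (n : ℕ) (p : Hspace n) : HasFDerivAt (NN n)
    ((2 * zSq n p) • dz n p + (2 * p.2.2) • ((ContinuousLinearMap.snd ℝ (Fin n → ℝ) ℝ).comp
        (ContinuousLinearMap.snd ℝ (Fin n → ℝ) ((Fin n → ℝ) × ℝ)))) p := by
  unfold NN
  refine (((hasFDerivAt_zSq n p).pow 2).add ((hasFDerivAt_t n p).pow 2)).congr_fderiv ?_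
  ext v <;> simp

lemma Xd_NN (n : ℕ) (j : Fin n) (p : Hspace n) :
    Xd n j (NN n) p = 4 * zSq n p * p.1 j + 4 * p.2.1 j * p.2.2 := by
  simp only [Xd, (hasFDerivAt_NN n p).fderiv]
  simp [dz_x, dz_t]; ring

lemma Yd_NN (n : ℕ) (j : Fin n) (p : Hspace n) :
    Yd n j (NN n) p = 4 * zSq n p * p.2.1 j - 4 * p.1 j * p.2.2 := by
  simp only [Yd, (hasFDerivAt_NN n p).fderiv]
  simp [dz_y, dz_t]; ring

lemma XXd_NN (n : ℕ) (j : Fin n) (p : Hspace n) :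
    Xd n j (Xd n j (NN n)) p = 8 * (p.1 j) ^ 2 + 4 * zSq n p + 8 * (p.2.1 j) ^ 2 := by
  have h : Xd n j (NN n) = fun p => 4 * zSq n p * p.1 j + 4 * p.2.1 j * p.2.2 :=
    funext (Xd_NN n j)
  have hd := (((hasFDerivAt_zSq n p).const_mul 4).mul (hasFDerivAt_x n j p)).add
    (((hasFDerivAt_y n j p).const_mul 4).mul (hasFDerivAt_t n p))
  rw [h]
  have e := hd.fderiv
  simp only [Xd]
  erw [e]
  simp [dz_x, dz_t]; ring

lemma YYd_NN (n : ℕ) (j : Fin n) (p : Hspace n) :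
    Yd n j (Yd n j (NN n)) p = 8 * (p.1 j) ^ 2 + 4 * zSq n p + 8 * (p.2.1 j) ^ 2 := by
  have h : Yd n j (NN n) = fun p => 4 * zSq n p * p.2.1 j - 4 * p.1 j * p.2.2 :=
    funext (Yd_NN n j)
  have hd := (((hasFDerivAt_zSq n p).const_mul 4).mul (hasFDerivAt_y n j p)).sub
    (((hasFDerivAt_x n j p).const_mul 4).mul (hasFDerivAt_t n p))
  rw [h]
  have e := hd.fderiv
  simp only [Yd]
  erw [e]
  simp [dz_y, dz_t]; ring

lemma NN_differentiable (n : ℕ) : Differentiable ℝ (NN n) :=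
  fun p => (hasFDerivAt_NN n p).differentiableAt

lemma Xd_congr (n : ℕ) (j : Fin n) {f g : Hspace n → ℝ} {p : Hspace n}
    (h : f =ᶠ[nhds p] g) : Xd n j f p = Xd n j g p := by
  simp only [Xd, h.fderiv_eq]

lemma Yd_congr (n : ℕ) (j : Fin n) {f g : Hspace n → ℝ} {p : Hspace n}
    (h : f =ᶠ[nhds p] g) : Yd n j f p = Yd n j g p := by
  simp only [Yd, h.fderiv_eq]

lemma Xd_comp (n : ℕ) (j : Fin n) {φ : ℝ → ℝ} {φ' : ℝ} {p : Hspace n}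
    (h : HasDerivAt φ φ' (NN n p)) : Xd n j (fun q => φ (NN n q)) p = φ' * Xd n j (NN n) p := by
  have := (h.comp_hasFDerivAt p (NN_differentiable n p).hasFDerivAt).fderiv
  simp only [Function.comp_def] at this
  simp only [Xd, this]
  simp; ring

lemma Yd_comp (n : ℕ) (j : Fin n) {φ : ℝ → ℝ} {φ' : ℝ} {p : Hspace n}
    (h : HasDerivAt φ φ' (NN n p)) : Yd n j (fun q => φ (NN n q)) p = φ' * Yd n j (NN n) p := by
  have := (h.comp_hasFDerivAt p (NN_differentiable n p).hasFDerivAt).fderiv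
  simp only [Function.comp_def] at this
  simp only [Yd, this]
  simp; ring

lemma Xd_mul (n : ℕ) (j : Fin n) {f g : Hspace n → ℝ} {p : Hspace n}
    (hf : DifferentiableAt ℝ f p) (hg : DifferentiableAt ℝ g p) :
    Xd n j (fun q => f q * g q) p = Xd n j f p * g p + f p * Xd n j g p := by
  simp only [Xd, fderiv_fun_mul hf hg]
  simp; ring

lemma Yd_mul (n : ℕ) (j : Fin n) {f g : Hspace n → ℝ} {p : Hspace n}
    (hf : DifferentiableAt ℝ f p) (hg : DifferentiableAt ℝ g p) :
    Yd n j (fun q => f q * g q) p = Yd n j f p * g p + f p * Yd n j g p := by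
  simp only [Yd, fderiv_fun_mul hf hg]
  simp; ring

lemma Xd_NN_diff (n : ℕ) (j : Fin n) : Differentiable ℝ (Xd n j (NN n)) := by
  have h : Xd n j (NN n) = fun p => 4 * zSq n p * p.1 j + 4 * p.2.1 j * p.2.2 :=
    funext (Xd_NN n j)
  have := (zSq_contDiff n).differentiable (by simp)
  rw [h]; fun_prop

lemma Yd_NN_diff (n : ℕ) (j : Fin n) : Differentiable ℝ (Yd n j (NN n)) := by
  have h : Yd n j (NN n) = fun p => 4 * zSq n p * p.2.1 j - 4 * p.1 j * p.2.2 :=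
    funext (Yd_NN n j)
  have := (zSq_contDiff n).differentiable (by simp)
  rw [h]; fun_prop

lemma lapH_comp (n : ℕ) {f : Hspace n → ℝ} {φ φ1 φ2 : ℝ → ℝ} {p : Hspace n}
    (hp : 0 < NN n p) (hf : ∀ q, 0 < NN n q → f q = φ (NN n q))
    (h1 : ∀ u, 0 < u → HasDerivAt φ (φ1 u) u) (h2 : ∀ u, 0 < u → HasDerivAt φ1 (φ2 u) u) :
    lapH n f p = zSq n p * (16 * NN n p * φ2 (NN n p) + 8 * (n + 2) * φ1 (NN n p)) := by
  have hopen : IsOpen {q | 0 < NN n q} := isOpen_lt continuous_const (NN_contDiff n).continuous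
  have hev : ∀ q, 0 < NN n q → f =ᶠ[nhds q] fun q => φ (NN n q) := fun q hq => by
    filter_upwards [hopen.mem_nhds hq] with r hr using hf r hr
  have hd1 : DifferentiableAt ℝ (fun q => φ1 (NN n q)) p :=
    ((h2 _ hp).differentiableAt.comp p (NN_differentiable n p))
  have hX : ∀ j, Xd n j (Xd n j f) p = φ2 (NN n p) * (Xd n j (NN n) p) ^ 2
      + φ1 (NN n p) * Xd n j (Xd n j (NN n)) p := fun j => by
    have : Xd n j f =ᶠ[nhds p] fun q => φ1 (NN n q) * Xd n j (NN n) q := by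
      filter_upwards [hopen.mem_nhds hp] with r hr
      rw [Xd_congr n j (hev r hr), Xd_comp n j (h1 _ hr)]
    rw [Xd_congr n j this, Xd_mul n j hd1 (Xd_NN_diff n j p), Xd_comp n j (h2 _ hp)]
    ring
  have hY : ∀ j, Yd n j (Yd n j f) p = φ2 (NN n p) * (Yd n j (NN n) p) ^ 2
      + φ1 (NN n p) * Yd n j (Yd n j (NN n)) p := fun j => by
    have : Yd n j f =ᶠ[nhds p] fun q => φ1 (NN n q) * Yd n j (NN n) q := by
      filter_upwards [hopen.mem_nhds hp] with r hr
      rw [Yd_congr n j (hev r hr), Yd_comp n j (h1 _ hr)]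
    rw [Yd_congr n j this, Yd_mul n j hd1 (Yd_NN_diff n j p), Yd_comp n j (h2 _ hp)]
    ring
  have key : ∀ j : Fin n, Xd n j (Xd n j f) p + Yd n j (Yd n j f) p =
      (φ2 (NN n p) * 16 * NN n p + φ1 (NN n p) * 16) * ((p.1 j) ^ 2 + (p.2.1 j) ^ 2)
      + φ1 (NN n p) * 8 * zSq n p := fun j => by
    rw [hX, hY, XXd_NN, YYd_NN, Xd_NN, Yd_NN]
    have : NN n p = (zSq n p) ^ 2 + p.2.2 ^ 2 := rfl
    generalize φ2 (NN n p) = a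
    generalize φ1 (NN n p) = b
    rw [this]; ring
  unfold lapH
  rw [Finset.sum_congr rfl fun j _ => key j, Finset.sum_add_distrib, ← Finset.mul_sum]
  simp only [Finset.sum_const, Finset.card_univ, Fintype.card_fin, nsmul_eq_mul]
  change _ * zSq n p + _ = _
  ring
/-- `log N` -/
def LL (n : ℕ) (p : Hspace n) : ℝ := Real.log (NN n p)

/-- the invariant weight -/
def WW (n : ℕ) (p : Hspace n) : ℝ := zSq n p * Real.exp (-((n + 2) / 2) * LL n p)

lemma WW_nonneg (n : ℕ) (p : Hspace n) : 0 ≤ WW n p :=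
  mul_nonneg (zSq_nonneg n p) (Real.exp_pos _).le

lemma LL_meas (n : ℕ) : Measurable (LL n) :=
  Real.measurable_log.comp (NN_contDiff n).continuous.measurable

lemma WW_meas (n : ℕ) : Measurable (WW n) :=
  (zSq_contDiff n).continuous.measurable.mul
    (Real.measurable_exp.comp ((LL_meas n).const_mul _))

/-- push-forward of the weight by `log N` -/
def mm (n : ℕ) : Measure ℝ :=
  ((volume : Measure (Hspace n)).withDensity fun p => ENNReal.ofReal (WW n p)).map (LL n)

lemma lintegral_mm (n : ℕ) {φ : ℝ → ENNReal} (hφ : Measurable φ) :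
    ∫⁻ v, φ v ∂(mm n) = ∫⁻ p : Hspace n, ENNReal.ofReal (WW n p) * φ (LL n p) := by
  unfold mm
  rw [lintegral_map hφ (LL_meas n)]
  exact lintegral_withDensity_eq_lintegral_mul _ (WW_meas n).ennreal_ofReal (hφ.comp (LL_meas n))

/-- dilations -/
def dil (n : ℕ) (l : ℝ) : Hspace n →ₗ[ℝ] Hspace n :=
  LinearMap.prodMap (l • LinearMap.id) (LinearMap.prodMap (l • LinearMap.id) (l ^ 2 • LinearMap.id))

lemma det_dil (n : ℕ) (l : ℝ) : LinearMap.det (dil n l) = l ^ (2 * n + 2) := by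
  unfold dil
  rw [LinearMap.det_prodMap, LinearMap.det_prodMap, LinearMap.det_smul, LinearMap.det_smul]
  simp; ring

lemma zSq_dil (n : ℕ) (l : ℝ) (p : Hspace n) : zSq n (dil n l p) = l ^ 2 * zSq n p := by
  simp only [zSq, dil, Finset.mul_sum]
  refine Finset.sum_congr rfl fun i _ => ?_
  simp; ring

lemma NN_dil (n : ℕ) (l : ℝ) (p : Hspace n) : NN n (dil n l p) = l ^ 4 * NN n p := by
  have : (dil n l p).2.2 = l ^ 2 * p.2.2 := by simp [dil]
  simp only [NN, zSq_dil, this]; ring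

lemma lintegral_dil (n : ℕ) {l : ℝ} (hl : 0 < l) {F : Hspace n → ENNReal} (hF : Measurable F) :
    ∫⁻ p, F (dil n l p) = ENNReal.ofReal ((l ^ (2 * n + 2))⁻¹) * ∫⁻ p, F p := by
  have hdet : LinearMap.det (dil n l) ≠ 0 := by rw [det_dil]; positivity
  have i1 : (volume : Measure ((Fin n → ℝ) × ℝ)).IsAddHaarMeasure :=
    Measure.prod.instIsAddHaarMeasure volume volume
  have i2 : (volume : Measure (Hspace n)).IsAddHaarMeasure :=
    Measure.prod.instIsAddHaarMeasure volume volume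
  have hm : Measurable (dil n l) := (LinearMap.continuous_of_finiteDimensional _).measurable
  rw [← lintegral_map hF hm, Measure.map_linearMap_addHaar_eq_smul_addHaar _ hdet, det_dil,
    lintegral_smul_measure, abs_of_pos (by positivity)]
  rfl

lemma zSq_eq_zero (n : ℕ) {p : Hspace n} (h : ¬ 0 < NN n p) : zSq n p = 0 := by
  have h1 : NN n p = (zSq n p) ^ 2 + p.2.2 ^ 2 := rfl
  nlinarith [sq_nonneg (zSq n p), sq_nonneg p.2.2]

lemma mm_shift (n : ℕ) (s : Set ℝ) (hs : MeasurableSet s) (τ : ℝ) :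
    mm n ((fun v => v + τ) ⁻¹' s) = mm n s := by
  have hl : 0 < Real.exp (τ / 4) := Real.exp_pos _
  have e : ∀ t, MeasurableSet t → mm n t =
      ∫⁻ p : Hspace n, ENNReal.ofReal (WW n p) * t.indicator 1 (LL n p) := fun t ht => by
    rw [← lintegral_mm n (measurable_one.indicator ht), lintegral_indicator_one ht]
  have hms : MeasurableSet ((fun v => v + τ) ⁻¹' s) := (measurable_id.add_const τ) hs
  have hF : Measurable fun p : Hspace n => ENNReal.ofReal (WW n p) * s.indicator 1 (LL n p) :=
    (WW_meas n).ennreal_ofReal.mul ((measurable_one.indicator hs).comp (LL_meas n))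
  have key := lintegral_dil n hl hF
  have hpt : ∀ p : Hspace n, ENNReal.ofReal (WW n (dil n (Real.exp (τ / 4)) p)) *
      s.indicator 1 (LL n (dil n (Real.exp (τ / 4)) p)) =
      ENNReal.ofReal (((Real.exp (τ / 4)) ^ (2 * n + 2))⁻¹) * (ENNReal.ofReal (WW n p) *
        ((fun v => v + τ) ⁻¹' s).indicator 1 (LL n p)) := fun p => by
    by_cases hp : 0 < NN n p
    · have hL : LL n (dil n (Real.exp (τ / 4)) p) = LL n p + τ := by
        unfold LL
        rw [NN_dil, Real.log_mul (by positivity) hp.ne', ← Real.exp_nat_mul, Real.log_exp]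
        push_cast; ring
      have hW : WW n (dil n (Real.exp (τ / 4)) p) =
          ((Real.exp (τ / 4)) ^ (2 * n + 2))⁻¹ * WW n p := by
        simp only [WW, hL, zSq_dil, ← Real.exp_nat_mul, ← Real.exp_neg]
        have : Real.exp (-((n + 2) / 2) * (LL n p + τ)) * Real.exp ((2 : ℕ) * (τ / 4)) =
          Real.exp (-(((2 * n + 2 : ℕ) : ℝ) * (τ / 4))) * Real.exp (-((n + 2) / 2) * LL n p) := by
          rw [← Real.exp_add, ← Real.exp_add]; congr 1; push_cast; ring
        linear_combination zSq n p * this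
      rw [hL, hW, ENNReal.ofReal_mul (by positivity), mul_assoc]
      rfl
    · have h1 := zSq_eq_zero n hp
      simp [WW, h1, zSq_dil]
  simp_rw [hpt] at key
  rw [lintegral_const_mul' _ _ ENNReal.ofReal_ne_top, ← e _ hs, ← e _ hms] at key
  exact (ENNReal.mul_right_inj (by
    rw [Ne, ENNReal.ofReal_eq_zero, not_le]; positivity) ENNReal.ofReal_ne_top).1 key

lemma mm_unit (n : ℕ) (a : ℝ) : mm n (Set.Ico a (a + 1)) = mm n (Set.Ico 0 1) := by
  rw [← mm_shift n (Set.Ico a (a + 1)) measurableSet_Ico a]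
  congr 1
  ext v; simp [add_comm]

lemma mm_Ico (n : ℕ) (a : ℝ) (m : ℕ) : mm n (Set.Ico a (a + m)) = m * mm n (Set.Ico 0 1) := by
  induction m with
  | zero => simp
  | succ m ih =>
    have : Set.Ico a (a + (m + 1 : ℕ)) = Set.Ico a (a + m) ∪ Set.Ico (a + m) (a + m + 1) := by
      rw [Set.Ico_union_Ico_eq_Ico] <;> push_cast
      · rw [add_assoc]
      · simp
      · simp
    rw [this, measure_union _ measurableSet_Ico, ih, mm_unit]
    · push_cast; ring
    · exact Set.Ico_disjoint_Ico_same

lemma NN_compact (n : ℕ) (c : ℝ) : IsCompact {p : Hspace n | NN n p ≤ c} := by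
  refine Metric.isCompact_of_isClosed_isBounded
    (isClosed_le (NN_contDiff n).continuous continuous_const) ?_
  refine (Metric.isBounded_closedBall (x := (0 : Hspace n)) (r := 1 + |c|)).subset fun p hp => ?_
  have hp' : (zSq n p) ^ 2 + p.2.2 ^ 2 ≤ c := hp
  have hc : 0 ≤ c := by nlinarith [sq_nonneg (zSq n p), sq_nonneg p.2.2]
  have hz := zSq_nonneg n p
  have hz1 : zSq n p ≤ 1 + c := by nlinarith [sq_nonneg p.2.2]
  have hx : ∀ i, p.1 i ^ 2 + p.2.1 i ^ 2 ≤ zSq n p := fun i =>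
    Finset.single_le_sum (f := fun j => p.1 j ^ 2 + p.2.1 j ^ 2)
      (fun j _ => by positivity) (Finset.mem_univ i)
  rw [mem_closedBall_zero_iff, abs_of_nonneg hc, Prod.norm_def, Prod.norm_def]
  refine max_le ?_ (max_le ?_ ?_)
  · refine (pi_norm_le_iff_of_nonneg (by positivity)).2 fun i => ?_
    have := hx i
    exact abs_le_of_sq_le_sq (by nlinarith [sq_nonneg (p.2.1 i)]) (by positivity)
  · refine (pi_norm_le_iff_of_nonneg (by positivity)).2 fun i => ?_
    have := hx i
    exact abs_le_of_sq_le_sq (by nlinarith [sq_nonneg (p.1 i)]) (by positivity)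
  · exact abs_le_of_sq_le_sq (by nlinarith) (by positivity)

lemma mm_eq (n : ℕ) (s : Set ℝ) (hs : MeasurableSet s) :
    mm n s = ∫⁻ p in LL n ⁻¹' s, ENNReal.ofReal (WW n p) := by
  unfold mm
  rw [Measure.map_apply (LL_meas n) hs, withDensity_apply _ (LL_meas n hs)]

lemma mm_unit_lt_top (n : ℕ) : mm n (Set.Ico 0 1) < ⊤ := by
  rw [mm_eq n _ measurableSet_Ico]
  have hsub : LL n ⁻¹' (Set.Ico 0 1) ⊆ {p : Hspace n | NN n p ≤ Real.exp 1} := fun p hp => by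
    by_cases h0 : 0 < NN n p
    · have h : Real.log (NN n p) < 1 := hp.2
      exact ((Real.log_lt_iff_lt_exp h0).1 h).le
    · exact (not_lt.1 h0).trans (Real.exp_pos _).le
  refine setLIntegral_lt_top_of_le_nnreal
    ((measure_mono hsub).trans_lt (NN_compact n _).measure_lt_top).ne
    ⟨Real.toNNReal (1 + Real.exp 1), fun p hp => ENNReal.ofReal_le_ofReal ?_⟩
  have h1 : (zSq n p) ^ 2 + p.2.2 ^ 2 ≤ Real.exp 1 := hsub hp
  have hz := zSq_nonneg n p
  have hz1 : zSq n p ≤ 1 + Real.exp 1 := by nlinarith [sq_nonneg p.2.2]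
  have h2 : Real.exp (-((n + 2) / 2) * LL n p) ≤ 1 := by
    rw [Real.exp_le_one_iff]
    have h3 : 0 ≤ LL n p := hp.1
    have : 0 ≤ ((n : ℝ) + 2) / 2 * LL n p := by positivity
    linarith
  unfold WW
  nlinarith [Real.exp_pos (-((n + 2) / 2) * LL n p)]

lemma mm_unit_pos (n : ℕ) (hn : 1 ≤ n) : 0 < mm n (Set.Ico 0 1) := by
  rw [mm_eq n _ measurableSet_Ico, setLIntegral_pos_iff (WW_meas n).ennreal_ofReal]
  have hN := (NN_contDiff n).continuous
  have hz := (zSq_contDiff n).continuous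
  have ho : IsOpen {p : Hspace n | 1 < NN n p ∧ NN n p < Real.exp 1 ∧ 0 < zSq n p} :=
    (isOpen_lt continuous_const hN).inter
      ((isOpen_lt hN continuous_const).inter (isOpen_lt continuous_const hz))
  have hne : {p : Hspace n | 1 < NN n p ∧ NN n p < Real.exp 1 ∧ 0 < zSq n p}.Nonempty := by
    have h1 : zSq n (Pi.single ⟨0, hn⟩ 1, 0, 1) = 1 := by
      simp [zSq, Pi.single_apply]
    refine ⟨(Pi.single ⟨0, hn⟩ 1, 0, 1), ?_, ?_, ?_⟩
    · simp [NN, h1]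
    · simp only [NN, h1]; have := Real.exp_one_gt_d9; norm_num; linarith
    · simp [h1]
  refine (ho.measure_pos volume hne).trans_le (measure_mono ?_)
  rintro p ⟨h1, h2, h3⟩
  refine ⟨?_, ?_, ?_⟩
  · simp only [Function.mem_support, Ne, ENNReal.ofReal_eq_zero, not_le]
    exact mul_pos h3 (Real.exp_pos _)
  · exact Real.log_nonneg h1.le
  · exact (Real.log_lt_iff_lt_exp (by linarith)).2 h2
lemma deriv_zero_of_const {h h1 : ℝ → ℝ} (hd : ∀ v, HasDerivAt h (h1 v) v) {U : Set ℝ}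
    (hU : IsOpen U) {c : ℝ} (hc : ∀ v ∈ U, h v = c) : ∀ v ∈ U, h1 v = 0 := fun v hv => by
  have : h =ᶠ[nhds v] fun _ => c := by
    filter_upwards [hU.mem_nhds hv] with w hw using hc w hw
  exact (hd v).unique ((hasDerivAt_const v c).congr_of_eventuallyEq this)

lemma cutoff_base : ∃ (S S1 S2 : ℝ → ℝ) (M : ℝ), ContDiff ℝ (⊤ : ℕ∞) S ∧
    (∀ v, HasDerivAt S (S1 v) v) ∧ (∀ v, HasDerivAt S1 (S2 v) v) ∧ 0 ≤ M ∧
    (∀ v, |S v| ≤ 1) ∧ (∀ v, |S1 v| ≤ M) ∧ (∀ v, |S2 v| ≤ M) ∧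
    (∀ v, v ≤ 0 → S v = 0) ∧ (∀ v, 1 ≤ v → S v = 1) := by
  have hS : ContDiff ℝ (⊤ : ℕ∞) Real.smoothTransition := Real.smoothTransition.contDiff
  have hS1 : ContDiff ℝ (⊤ : ℕ∞) (deriv Real.smoothTransition) :=
    (contDiff_infty_iff_deriv.1 hS).2
  have hS2 : ContDiff ℝ (⊤ : ℕ∞) (deriv (deriv Real.smoothTransition)) :=
    (contDiff_infty_iff_deriv.1 hS1).2
  have d1 : ∀ v, HasDerivAt Real.smoothTransition (deriv Real.smoothTransition v) v :=
    fun v => (hS.differentiable (by simp) v).hasDerivAt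
  have d2 : ∀ v, HasDerivAt (deriv Real.smoothTransition)
      (deriv (deriv Real.smoothTransition) v) v :=
    fun v => (hS1.differentiable (by simp) v).hasDerivAt
  have hc : HasCompactSupport (deriv Real.smoothTransition) := by
    refine HasCompactSupport.intro (isCompact_Icc (a := (0 : ℝ)) (b := 1)) fun v hv => ?_
    by_cases h0 : v < 0
    · exact deriv_zero_of_const d1 isOpen_Iio
        (fun w hw => Real.smoothTransition.zero_of_nonpos (le_of_lt hw)) v h0
    · have h1 : 1 < v := by
        by_contra h
        exact hv ⟨not_lt.1 h0, not_lt.1 h⟩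
      exact deriv_zero_of_const d1 isOpen_Ioi
        (fun w hw => Real.smoothTransition.one_of_one_le (le_of_lt hw)) v h1
  obtain ⟨M1, hM1⟩ := hc.exists_bound_of_continuous hS1.continuous
  obtain ⟨M2, hM2⟩ := hc.deriv.exists_bound_of_continuous hS2.continuous
  refine ⟨_, _, _, max M1 M2, hS, d1, d2, ?_, ?_, ?_, ?_, ?_, ?_⟩
  · exact ((norm_nonneg _).trans (hM1 0)).trans (le_max_left _ _)
  · exact fun v => abs_le.2 ⟨by linarith [Real.smoothTransition.nonneg v],
      Real.smoothTransition.le_one v⟩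
  · exact fun v => (hM1 v).trans (le_max_left _ _)
  · exact fun v => (hM2 v).trans (le_max_right _ _)
  · exact fun v => Real.smoothTransition.zero_of_nonpos
  · exact fun v => Real.smoothTransition.one_of_one_le

lemma cutoff : ∃ M : ℝ, 0 ≤ M ∧ ∀ R : ℝ, ∃ h h1 h2 : ℝ → ℝ, ContDiff ℝ (⊤ : ℕ∞) h ∧
    (∀ v, HasDerivAt h (h1 v) v) ∧ (∀ v, HasDerivAt h1 (h2 v) v) ∧
    (∀ v, |h v| ≤ 1) ∧ (∀ v, |h1 v| ≤ M) ∧ (∀ v, |h2 v| ≤ M) ∧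
    (∀ v, 0 ≤ v → v ≤ R → h v = 1 ∧ h1 v = 0 ∧ h2 v = 0) ∧
    (∀ v, v ≤ -2 → h v = 0) ∧ (∀ v, R + 2 ≤ v → h v = 0) ∧
    (∀ v, v < -2 → h v = 0 ∧ h1 v = 0 ∧ h2 v = 0) ∧
    (∀ v, R + 2 < v → h v = 0 ∧ h1 v = 0 ∧ h2 v = 0) := by
  obtain ⟨S, S1, S2, M, hS, d1, d2, hM, b0, b1, b2, z0, o1⟩ := cutoff_base
  refine ⟨2 * M + 2 * M * M, by positivity, fun R => ?_⟩
  have eA : ∀ v, HasDerivAt (fun v => S (v + 2)) (S1 (v + 2)) v := fun v =>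
    (d1 (v + 2)).comp_add_const v 2
  have eA1 : ∀ v, HasDerivAt (fun v => S1 (v + 2)) (S2 (v + 2)) v := fun v =>
    (d2 (v + 2)).comp_add_const v 2
  have eB : ∀ v, HasDerivAt (fun v => S (R + 2 - v)) (-S1 (R + 2 - v)) v := fun v =>
    (d1 (R + 2 - v)).comp_const_sub (R + 2) v
  have eB1 : ∀ v, HasDerivAt (fun v => S1 (R + 2 - v)) (-S2 (R + 2 - v)) v := fun v =>
    (d2 (R + 2 - v)).comp_const_sub (R + 2) v
  obtain ⟨h, hh⟩ : ∃ h : ℝ → ℝ, h = fun v => S (v + 2) * S (R + 2 - v) := ⟨_, rfl⟩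
  obtain ⟨h1, hh1⟩ : ∃ h1 : ℝ → ℝ, h1 = fun v =>
    S1 (v + 2) * S (R + 2 - v) + S (v + 2) * (-S1 (R + 2 - v)) := ⟨_, rfl⟩
  obtain ⟨h2, hh2⟩ : ∃ h2 : ℝ → ℝ, h2 = fun v =>
    (S2 (v + 2) * S (R + 2 - v) + S1 (v + 2) * (-S1 (R + 2 - v))) +
    (S1 (v + 2) * (-S1 (R + 2 - v)) + S (v + 2) * (-(-S2 (R + 2 - v)))) := ⟨_, rfl⟩
  have D1 : ∀ v, HasDerivAt h (h1 v) v := fun v => by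
    rw [hh, hh1]; exact (eA v).mul (eB v)
  have D2 : ∀ v, HasDerivAt h1 (h2 v) v := fun v => by
    rw [hh1, hh2]; exact ((eA1 v).mul (eB v)).add ((eA v).mul (eB1 v).neg)
  have loc : ∀ (U : Set ℝ) (c : ℝ), IsOpen U → (∀ v ∈ U, h v = c) → ∀ v ∈ U,
      h v = c ∧ h1 v = 0 ∧ h2 v = 0 := fun U c hU hc v hv => by
    have a1 := deriv_zero_of_const D1 hU hc
    exact ⟨hc v hv, a1 v hv, deriv_zero_of_const D2 hU a1 v hv⟩
  have hz1 : ∀ v, v ≤ -2 → h v = 0 := fun v hv => by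
    rw [hh]; simp [z0 (v + 2) (by linarith)]
  have hz2 : ∀ v, R + 2 ≤ v → h v = 0 := fun v hv => by
    rw [hh]; simp [z0 (R + 2 - v) (by linarith)]
  have mulb : ∀ a b c d : ℝ, 0 ≤ c → |a| ≤ c → |b| ≤ d → |a * b| ≤ c * d :=
    fun a b c d hc ha hb => by
      rw [abs_mul]; exact mul_le_mul ha hb (abs_nonneg _) hc
  refine ⟨h, h1, h2, ?_, D1, D2, ?_, ?_, ?_, ?_, hz1, hz2, ?_, ?_⟩
  · rw [hh]
    exact (hS.comp (contDiff_id.add contDiff_const)).mul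
      (hS.comp (contDiff_const.sub contDiff_id))
  · intro v; rw [hh]
    simpa using mulb _ _ 1 1 zero_le_one (b0 (v + 2)) (b0 (R + 2 - v))
  · intro v; rw [hh1]
    have a1 := mulb _ _ _ _ hM (b1 (v + 2)) (b0 (R + 2 - v))
    have a2 := mulb _ (-S1 (R + 2 - v)) _ M zero_le_one (b0 (v + 2))
      (by rw [abs_neg]; exact b1 _)
    refine (abs_add_le _ _).trans ?_
    nlinarith
  · intro v; rw [hh2]
    have a1 := mulb _ _ _ _ hM (b2 (v + 2)) (b0 (R + 2 - v))
    have a2 := mulb _ (-S1 (R + 2 - v)) _ M hM (b1 (v + 2))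
      (by rw [abs_neg]; exact b1 _)
    have a3 := mulb _ (-(-S2 (R + 2 - v))) _ M zero_le_one (b0 (v + 2))
      (by rw [neg_neg]; exact b2 _)
    have a4 := abs_add_le (S2 (v + 2) * S (R + 2 - v)) (S1 (v + 2) * (-S1 (R + 2 - v)))
    have a5 := abs_add_le (S1 (v + 2) * (-S1 (R + 2 - v))) (S (v + 2) * (-(-S2 (R + 2 - v))))
    refine (abs_add_le _ _).trans ?_
    nlinarith
  · intro v hv0 hv1
    refine loc (Set.Ioo (-1) (R + 1)) 1 isOpen_Ioo (fun w hw => ?_) v ⟨by linarith, by linarith⟩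
    rw [hh]
    simp [o1 (w + 2) (by linarith [hw.1]), o1 (R + 2 - w) (by linarith [hw.2])]
  · exact loc (Set.Iio (-2)) 0 isOpen_Iio (fun w hw => hz1 w (le_of_lt hw))
  · exact loc (Set.Ioi (R + 2)) 0 isOpen_Ioi (fun w hw => hz2 w (le_of_lt hw))

lemma rho_rpow (n : ℕ) {p : Hspace n} (hp : 0 < NN n p) (β : ℝ) :
    rho n p ^ β = Real.exp (β / 4 * LL n p) := by
  change ((NN n p) ^ ((4 : ℝ)⁻¹)) ^ β = _
  rw [← Real.rpow_mul hp.le, Real.rpow_def_of_pos hp, LL]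
  congr 1; ring

/-- test functions -/
def ff (n : ℕ) (σ : ℝ) (h : ℝ → ℝ) (p : Hspace n) : ℝ :=
  if NN n p < Real.exp (-2) then 0 else Real.exp (σ * LL n p) * h (LL n p)

lemma ff_eq (n : ℕ) (σ : ℝ) {h : ℝ → ℝ} (hz : ∀ v, v ≤ -2 → h v = 0) {p : Hspace n}
    (hp : 0 < NN n p) : ff n σ h p = Real.exp (σ * LL n p) * h (LL n p) := by
  unfold ff
  split_ifs with hlt
  · rw [hz, mul_zero]
    exact ((Real.log_lt_iff_lt_exp hp).2 hlt).le
  · rfl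

lemma ff_contDiff (n : ℕ) (σ : ℝ) {h : ℝ → ℝ} (hh : ContDiff ℝ (⊤ : ℕ∞) h)
    (hz : ∀ v, v ≤ -2 → h v = 0) : ContDiff ℝ (⊤ : ℕ∞) (ff n σ h) := by
  rw [contDiff_iff_contDiffAt]
  intro p
  have hN := (NN_contDiff n).continuous
  by_cases hp : 0 < NN n p
  · have hev : ff n σ h =ᶠ[nhds p] fun q => Real.exp (σ * LL n q) * h (LL n q) := by
      filter_upwards [(isOpen_lt continuous_const hN).mem_nhds hp] with q hq
      exact ff_eq n σ hz hq
    refine ContDiffAt.congr_of_eventuallyEq ?_ hev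
    have hL : ContDiffAt ℝ (⊤ : ℕ∞) (LL n) p := (NN_contDiff n).contDiffAt.log hp.ne'
    exact (contDiffAt_const.mul hL).exp.mul (hh.contDiffAt.comp p hL)
  · have hp' : NN n p < Real.exp (-2) := (not_lt.1 hp).trans_lt (Real.exp_pos _)
    have hev : ff n σ h =ᶠ[nhds p] fun _ => 0 := by
      filter_upwards [(isOpen_lt hN continuous_const).mem_nhds hp'] with q hq
      exact if_pos hq
    exact contDiffAt_const.congr_of_eventuallyEq hev

lemma lapH_ff (n : ℕ) (σ : ℝ) {h h1 h2 : ℝ → ℝ} (hz : ∀ v, v ≤ -2 → h v = 0)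
    (d1 : ∀ v, HasDerivAt h (h1 v) v) (d2 : ∀ v, HasDerivAt h1 (h2 v) v) {p : Hspace n}
    (hp : 0 < NN n p) : lapH n (ff n σ h) p = zSq n p * (Real.exp (σ * LL n p) / NN n p) *
      ((16 * σ ^ 2 + 8 * n * σ) * h (LL n p) + (32 * σ + 8 * n) * h1 (LL n p)
        + 16 * h2 (LL n p)) := by
  have ed : ∀ v, HasDerivAt (fun v => Real.exp (σ * v)) (Real.exp (σ * v) * σ) v := fun v => by
    simpa using ((hasDerivAt_id v).const_mul σ).exp
  have E1 : ∀ v, HasDerivAt (fun v => Real.exp (σ * v) * h v)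
      (Real.exp (σ * v) * (σ * h v + h1 v)) v := fun v => by
    refine ((ed v).mul (d1 v)).congr_deriv ?_
    ring
  have E2 : ∀ v, HasDerivAt (fun v => Real.exp (σ * v) * (σ * h v + h1 v))
      (Real.exp (σ * v) * (σ ^ 2 * h v + 2 * σ * h1 v + h2 v)) v := fun v => by
    refine ((ed v).mul (((d1 v).const_mul σ).add (d2 v))).congr_deriv ?_
    simp only [Pi.add_apply]; ring
  rw [lapH_comp n (φ := fun u => Real.exp (σ * Real.log u) * h (Real.log u))
    (φ1 := fun u => Real.exp (σ * Real.log u) * (σ * h (Real.log u) + h1 (Real.log u)) * u⁻¹)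
    (φ2 := fun u => (Real.exp (σ * Real.log u) * (σ ^ 2 * h (Real.log u)
      + 2 * σ * h1 (Real.log u) + h2 (Real.log u)) -
      Real.exp (σ * Real.log u) * (σ * h (Real.log u) + h1 (Real.log u))) * (u ^ 2)⁻¹) hp
    (fun q hq => ff_eq n σ hz hq)]
  · change zSq n p * (16 * NN n p * ((Real.exp (σ * LL n p) * (σ ^ 2 * h (LL n p)
      + 2 * σ * h1 (LL n p) + h2 (LL n p)) -
      Real.exp (σ * LL n p) * (σ * h (LL n p) + h1 (LL n p))) * ((NN n p) ^ 2)⁻¹) +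
      8 * (n + 2) * (Real.exp (σ * LL n p) * (σ * h (LL n p) + h1 (LL n p)) * (NN n p)⁻¹)) = _
    have := hp.ne'
    field_simp
    ring
  · intro u hu
    exact (E1 (Real.log u)).comp u (Real.hasDerivAt_log hu.ne')
  · intro u hu
    refine (((E2 (Real.log u)).comp u (Real.hasDerivAt_log hu.ne')).mul
      (hasDerivAt_inv hu.ne')).congr_deriv ?_
    simp only [Function.comp_apply]
    have := hu.ne'
    field_simp
    ring

/-- sharpness of the constant `(Q + α − 4)² (Q − α)² / 16` in the
Rellich-type inequality on ℍⁿ: any larger constant `C` fails for some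
`f ∈ C_c^∞(ℝ^{2n+1} \ {0})`. -/
theorem heisenberg_rellich_sharp (n : ℕ) (hn : 1 ≤ n) (Q α : ℝ) (hQ : Q = 2 * n + 2)
    (hα : Q + α - 4 > 0) (C : ℝ) (hC : C > (Q + α - 4) ^ 2 * (Q - α) ^ 2 / 16) :
    ∃ f : Hspace n → ℝ, ContDiff ℝ (⊤ : ℕ∞) f ∧ HasCompactSupport f ∧
      (0 : Hspace n) ∉ tsupport f ∧
      0 < (∫⁻ p, ENNReal.ofReal (zSq n p * rho n p ^ (α - 6) * (f p) ^ 2)) ∧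
      (∫⁻ p, ENNReal.ofReal ((rho n p ^ (α + 2) / zSq n p) * (lapH n f p) ^ 2)) <
        ENNReal.ofReal C *
          ∫⁻ p, ENNReal.ofReal (zSq n p * rho n p ^ (α - 6) * (f p) ^ 2) := by
  obtain ⟨M, hM, hcut⟩ := cutoff
  obtain ⟨σ, hσ⟩ : ∃ σ : ℝ, σ = -(Q + α - 4) / 8 := ⟨_, rfl⟩
  obtain ⟨A, hA⟩ : ∃ A : ℝ, A = 16 * σ ^ 2 + 8 * n * σ := ⟨_, rfl⟩
  obtain ⟨B, hB⟩ : ∃ B : ℝ, B = 32 * σ + 8 * n := ⟨_, rfl⟩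
  have hA2 : A ^ 2 = (Q + α - 4) ^ 2 * (Q - α) ^ 2 / 16 := by
    have : (n : ℝ) = (Q - 2) / 2 := by linarith
    rw [hA, hσ, this]; ring
  rw [← hA2] at hC
  obtain ⟨K, hK⟩ : ∃ K : ℝ, K = |A| + |B| * M + 16 * M := ⟨_, rfl⟩
  obtain ⟨R, hR⟩ := exists_nat_gt (6 * K ^ 2 / (C - A ^ 2))
  have hR' : 6 * K ^ 2 < (C - A ^ 2) * R := by
    rwa [div_lt_iff₀' (by linarith)] at hR
  have hRpos : (0 : ℝ) < R := by
    have : 0 ≤ 6 * K ^ 2 / (C - A ^ 2) := div_nonneg (by positivity) (by linarith)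
    linarith
  obtain ⟨h, h1, h2, hh, d1, d2, b0, b1, b2, hbulk, hz1, hz2, hlo, hhi⟩ := hcut R
  obtain ⟨D, hD⟩ : ∃ D : ℝ → ℝ, D = fun v => A * h v + B * h1 v + 16 * h2 v := ⟨_, rfl⟩
  have hDK : ∀ v, D v ^ 2 ≤ K ^ 2 := fun v => by
    refine sq_le_sq' ?_ ?_ <;>
    · have a1 : |A * h v| ≤ |A| := by
        rw [abs_mul]; exact mul_le_of_le_one_right (abs_nonneg _) (b0 v)
      have a2 : |B * h1 v| ≤ |B| * M := by
        rw [abs_mul]; exact mul_le_mul_of_nonneg_left (b1 v) (abs_nonneg _)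
      have a3 := abs_le.1 (b2 v)
      have a1' := abs_le.1 a1
      have a2' := abs_le.1 a2
      rw [hD, hK]
      simp only
      linarith [a1'.1, a1'.2, a2'.1, a2'.2, a3.1, a3.2]
  have hlap : ∀ p : Hspace n, ENNReal.ofReal ((rho n p ^ (α + 2) / zSq n p) *
      (lapH n (ff n σ h) p) ^ 2) ≤ ENNReal.ofReal (WW n p) * ENNReal.ofReal (D (LL n p) ^ 2) := by
    intro p
    by_cases hz : zSq n p = 0
    · simp [hz]
    have hp : 0 < NN n p := by
      by_contra hp
      exact hz (zSq_eq_zero n hp)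
    rw [← ENNReal.ofReal_mul (WW_nonneg n p)]
    refine le_of_eq (congrArg _ ?_)
    rw [lapH_ff n σ hz1 d1 d2 hp, rho_rpow n hp, ← hA, ← hB]
    have hDp : A * h (LL n p) + B * h1 (LL n p) + 16 * h2 (LL n p) = D (LL n p) := by rw [hD]
    have hN : NN n p = Real.exp (LL n p) := (Real.exp_log hp).symm
    have hex : Real.exp ((α + 2) / 4 * LL n p) * (Real.exp (σ * LL n p) / NN n p) ^ 2 =
        Real.exp (-((n + 2) / 2) * LL n p) := by
      rw [hN, ← Real.exp_sub, ← Real.exp_nat_mul, ← Real.exp_add]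
      congr 1
      have : (n : ℝ) = (Q - 2) / 2 := by linarith
      rw [hσ, this]; push_cast; ring
    rw [hDp, WW, ← hex]
    generalize Real.exp ((α + 2) / 4 * LL n p) = a
    generalize (Real.exp (σ * LL n p) / NN n p) = b
    field_simp
  have hf : ∀ p : Hspace n, ENNReal.ofReal (zSq n p * rho n p ^ (α - 6) * (ff n σ h p) ^ 2) =
      ENNReal.ofReal (WW n p) * ENNReal.ofReal (h (LL n p) ^ 2) := by
    intro p
    by_cases hz : zSq n p = 0
    · simp [hz, WW]
    have hp : 0 < NN n p := by
      by_contra hp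
      exact hz (zSq_eq_zero n hp)
    rw [← ENNReal.ofReal_mul (WW_nonneg n p)]
    congr 1
    rw [ff_eq n σ hz1 hp, rho_rpow n hp]
    have hex : Real.exp ((α - 6) / 4 * LL n p) * (Real.exp (σ * LL n p)) ^ 2 =
        Real.exp (-((n + 2) / 2) * LL n p) := by
      rw [← Real.exp_nat_mul, ← Real.exp_add]
      congr 1
      have : (n : ℝ) = (Q - 2) / 2 := by linarith
      rw [hσ, this]; push_cast; ring
    rw [WW, ← hex]; ring
  obtain ⟨w, hw⟩ : ∃ w, w = mm n (Set.Ico 0 1) := ⟨_, rfl⟩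
  have hwpos : 0 < w := hw ▸ mm_unit_pos n hn
  have hwtop : w ≠ ⊤ := hw ▸ (mm_unit_lt_top n).ne
  -- lower bound of the right-hand side
  have hlow : (R : ENNReal) * w ≤
      ∫⁻ p, ENNReal.ofReal (zSq n p * rho n p ^ (α - 6) * (ff n σ h p) ^ 2) := by
    have e1 := mm_Ico n 0 R
    rw [zero_add, ← hw] at e1
    rw [← e1, ← lintegral_indicator_one measurableSet_Ico,
      lintegral_mm n (measurable_one.indicator measurableSet_Ico)]
    refine lintegral_mono fun p => ?_
    rw [hf]
    refine mul_le_mul_right ?_ _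
    by_cases hv : LL n p ∈ Set.Ico (0 : ℝ) R
    · rw [Set.indicator_of_mem hv, (hbulk _ hv.1 hv.2.le).1]; simp
    · rw [Set.indicator_of_notMem hv]; exact zero_le
  -- upper bound of the left-hand side
  have hup : (∫⁻ p, ENNReal.ofReal ((rho n p ^ (α + 2) / zSq n p) * (lapH n (ff n σ h) p) ^ 2)) ≤
      ENNReal.ofReal (A ^ 2) * (R * w) + (ENNReal.ofReal (K ^ 2) * (3 * w) +
        ENNReal.ofReal (K ^ 2) * (3 * w)) := by
    have e1 := mm_Ico n 0 R
    have e2 := mm_Ico n (-3) 3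
    have e3 := mm_Ico n R 3
    rw [← hw] at e1 e2 e3
    rw [zero_add] at e1
    push_cast at e2 e3
    rw [neg_add_cancel] at e2
    have m1 : Measurable ((Set.Ico (0 : ℝ) R).indicator fun _ => ENNReal.ofReal (A ^ 2)) :=
      measurable_const.indicator measurableSet_Ico
    have m2 : Measurable ((Set.Ico (-3 : ℝ) 0).indicator fun _ => ENNReal.ofReal (K ^ 2)) :=
      measurable_const.indicator measurableSet_Ico
    have m3 : Measurable ((Set.Ico (R : ℝ) (R + 3)).indicator fun _ => ENNReal.ofReal (K ^ 2)) :=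
      measurable_const.indicator measurableSet_Ico
    have i1 := lintegral_indicator_const (μ := mm n) (measurableSet_Ico (a := (0 : ℝ)) (b := R))
      (ENNReal.ofReal (A ^ 2))
    have i2 := lintegral_indicator_const (μ := mm n) (measurableSet_Ico (a := (-3 : ℝ)) (b := 0))
      (ENNReal.ofReal (K ^ 2))
    have i3 := lintegral_indicator_const (μ := mm n)
      (measurableSet_Ico (a := (R : ℝ)) (b := R + 3)) (ENNReal.ofReal (K ^ 2))
    rw [← e1, ← i1]
    nth_rewrite 1 [← e2]
    rw [← e3, ← i2, ← i3, ← lintegral_add_left m2, ← lintegral_add_left m1]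
    refine le_of_le_of_eq ?_ (lintegral_mm n (m1.add (m2.add m3))).symm
    refine lintegral_mono fun p => (hlap p).trans (mul_le_mul_right ?_ _)
    simp only [Pi.add_apply]
    generalize LL n p = v
    have hk := ENNReal.ofReal_le_ofReal (hDK v)
    by_cases c1 : v < -2
    · obtain ⟨q0, q1, q2⟩ := hlo v c1
      have : D v = 0 := by rw [hD]; simp [q0, q1, q2]
      simp [this]
    by_cases c2 : v < 0
    · rw [Set.indicator_of_mem (show v ∈ Set.Ico (-3 : ℝ) 0 from ⟨by linarith, c2⟩)]
      exact hk.trans (le_self_add.trans le_add_self)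
    by_cases c3 : v < R
    · obtain ⟨q0, q1, q2⟩ := hbulk v (not_lt.1 c2) c3.le
      have : D v = A := by rw [hD]; simp [q0, q1, q2]
      rw [Set.indicator_of_mem (show v ∈ Set.Ico (0 : ℝ) R from ⟨not_lt.1 c2, c3⟩), this]
      exact le_self_add
    by_cases c4 : v < R + 3
    · rw [Set.indicator_of_mem (show v ∈ Set.Ico (R : ℝ) (R + 3) from ⟨not_lt.1 c3, c4⟩)]
      exact hk.trans (le_add_self.trans le_add_self)
    · obtain ⟨q0, q1, q2⟩ := hhi v (by linarith)
      have : D v = 0 := by rw [hD]; simp [q0, q1, q2]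
      simp [this]
  have hRne : (R : ENNReal) ≠ 0 := by
    have : R ≠ 0 := by rintro rfl; simp at hRpos
    exact_mod_cast this
  have hsupp : Function.support (ff n σ h) ⊆
      {p | Real.exp (-2) ≤ NN n p} ∩ {p | NN n p ≤ Real.exp (R + 2)} := by
    intro p hp
    have hp1 : Real.exp (-2) ≤ NN n p := by
      by_contra hlt
      exact hp (if_pos (not_le.1 hlt))
    refine ⟨hp1, ?_⟩
    have hp0 : 0 < NN n p := (Real.exp_pos _).trans_le hp1
    by_contra hgt
    refine hp ?_
    rw [ff_eq n σ hz1 hp0, hz2, mul_zero]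
    exact ((Real.lt_log_iff_exp_lt hp0).2 (not_le.1 hgt)).le
  have hclosed : IsClosed {p : Hspace n | Real.exp (-2) ≤ NN n p} :=
    isClosed_le continuous_const (NN_contDiff n).continuous
  refine ⟨ff n σ h, ff_contDiff n σ hh hz1, ?_, ?_, ?_, ?_⟩
  · exact HasCompactSupport.of_support_subset_isCompact (NN_compact n _)
      (hsupp.trans Set.inter_subset_right)
  · intro h0
    have : (0 : Hspace n) ∈ {p : Hspace n | Real.exp (-2) ≤ NN n p} :=
      closure_minimal (hsupp.trans Set.inter_subset_left) hclosed h0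
    have h3 : NN n (0 : Hspace n) = 0 := by simp [NN, zSq]
    rw [Set.mem_ofPred_eq, h3] at this
    exact absurd this (not_le.2 (Real.exp_pos _))
  · exact (ENNReal.mul_pos hRne hwpos.ne').trans_le hlow
  · refine (hup.trans_lt ?_).trans_le (mul_le_mul_right hlow _)
    have hC0 : 0 ≤ C := (sq_nonneg A).trans hC.le
    have hl : ENNReal.ofReal (A ^ 2) * (R * w) + (ENNReal.ofReal (K ^ 2) * (3 * w) +
        ENNReal.ofReal (K ^ 2) * (3 * w)) = ENNReal.ofReal (A ^ 2 * R + 6 * K ^ 2) * w := by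
      rw [ENNReal.ofReal_add (by positivity) (by positivity), ENNReal.ofReal_mul (by positivity),
        ENNReal.ofReal_mul (by positivity), ENNReal.ofReal_natCast, ENNReal.ofReal_ofNat]
      ring
    have hr : ENNReal.ofReal C * (R * w) = ENNReal.ofReal (C * R) * w := by
      rw [ENNReal.ofReal_mul hC0, ENNReal.ofReal_natCast, mul_assoc]
    rw [hl, hr]
    refine ENNReal.mul_lt_mul_left hwpos.ne' hwtop ?_
    exact (ENNReal.ofReal_lt_ofReal_iff (by nlinarith [sq_nonneg K])).2 (by nlinarith)
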